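/- arXiv:1102.0344 — 2 statements merged into one kernel-verified Lean document; each statement's English description precedes it below -/
import Mathlib

section
/- Let m : ℝ → ℝ⁵ be a C^∞ curve with ⟨m, m⟩ = 0 and ⟨m', m'⟩ = 1 identically, and set F₂ = ⟨m'', m''⟩, F₃ = ⟨m''', m'''⟩. Then the Lorentz vector product X(s) = m(s) × m'(s) × m''(s) × m'''(s) satisfies ⟨X(s), X(s)⟩ = F₃(s) − F₂(s)² for all s. (For a space curve of curvature κ and torsion τ this equals (κ')² + κ²τ² = ν², the square of Liebmann's conformal arc-length density, so the normalized X is the curve of osculating spheres.) -/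
noncomputable section

/-- The Minkowski bilinear form on `ℝ⁵₁`:
`⟨x,y⟩ = -x₀y₀ + x₁y₁ + x₂y₂ + x₃y₃ + x₄y₄`. -/
def mink5 (x y : Fin 5 → ℝ) : ℝ :=
  -(x 0 * y 0) + x 1 * y 1 + x 2 * y 2 + x 3 * y 3 + x 4 * y 4

/-- The standard basis vector `eⁱ` of `ℝ⁵`. -/
def stdb (i : Fin 5) : Fin 5 → ℝ := fun k => if k = i then 1 else 0

/-- The Lorentz vector product `w = u¹×u²×u³×u⁴` of four vectors of `ℝ⁵₁`, given
componentwise by `w₀ = -det(e⁰ u¹ u² u³ u⁴)` and `wᵢ = det(eⁱ u¹ u² u³ u⁴)` for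
`i = 1,…,4`, where the determinants are of the `5×5` matrices having the indicated
columns. -/
def lorentzProd (u : Fin 4 → Fin 5 → ℝ) : Fin 5 → ℝ := fun i =>
  (if i = 0 then (-1 : ℝ) else 1) *
    (Matrix.of fun k j : Fin 5 => (Fin.cons (stdb i) u : Fin 5 → Fin 5 → ℝ) j k).det

theorem mink5_hasDerivAt {p q : ℝ → Fin 5 → ℝ} {p' q' : Fin 5 → ℝ} {s : ℝ}
    (hp : HasDerivAt p p' s) (hq : HasDerivAt q q' s) :
    HasDerivAt (fun t => mink5 (p t) (q t)) (mink5 p' (q s) + mink5 (p s) q') s := by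
  rw [hasDerivAt_pi] at hp hq
  have h := fun i => (hp i).mul (hq i)
  have := ((((h 0).neg.add (h 1)).add (h 2)).add (h 3)).add (h 4)
  refine this.congr_deriv ?_
  simp only [mink5]
  ring

theorem lorentz_comp_sq (u : Fin 4 → Fin 5 → ℝ) (f g c : ℝ)
    (h00 : mink5 (u 0) (u 0) = 0) (h01 : mink5 (u 0) (u 1) = 0)
    (h02 : mink5 (u 0) (u 2) = -1) (h03 : mink5 (u 0) (u 3) = 0)
    (h11 : mink5 (u 1) (u 1) = 1) (h12 : mink5 (u 1) (u 2) = 0)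
    (h13 : mink5 (u 1) (u 3) = -f) (h22 : mink5 (u 2) (u 2) = f)
    (h23 : mink5 (u 2) (u 3) = c) (h33 : mink5 (u 3) (u 3) = g) (i : Fin 5) (e : ℝ)
    (he : e = if i = 0 then -1 else 1) :
    lorentzProd u i ^ 2 = - (!![e, e * u 0 i, e * u 1 i, e * u 2 i, e * u 3 i;
      e * u 0 i, 0, 0, -1, 0;
      e * u 1 i, 0, 1, 0, -f;
      e * u 2 i, -1, 0, f, c;
      e * u 3 i, 0, -f, c, g] : Matrix (Fin 5) (Fin 5) ℝ).det := by
  set M : Matrix (Fin 5) (Fin 5) ℝ :=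
    Matrix.of fun k j : Fin 5 => (Fin.cons (stdb i) u : Fin 5 → Fin 5 → ℝ) j k with hM
  set J : Matrix (Fin 5) (Fin 5) ℝ := Matrix.diagonal ![-1, 1, 1, 1, 1] with hJ
  have hg : ∀ a b, (M.transpose * J * M) a b =
      mink5 ((Fin.cons (stdb i) u : Fin 5 → Fin 5 → ℝ) a)
        ((Fin.cons (stdb i) u : Fin 5 → Fin 5 → ℝ) b) := by
    intro a b
    rw [Matrix.mul_apply]
    simp only [hJ, Matrix.mul_diagonal, Fin.sum_univ_five, mink5, hM, Matrix.transpose_apply,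
      Matrix.of_apply]
    simp
  have comm : ∀ x y, mink5 x y = mink5 y x := by
    intro x y; simp only [mink5]; ring
  have hs : ∀ x, mink5 (stdb i) x = e * x i := by
    intro x; subst he; fin_cases i <;> simp [mink5, stdb]
  have hsi : stdb i i = 1 := by simp [stdb]
  have key : M.transpose * J * M = !![e, e * u 0 i, e * u 1 i, e * u 2 i, e * u 3 i;
      e * u 0 i, 0, 0, -1, 0;
      e * u 1 i, 0, 1, 0, -f;
      e * u 2 i, -1, 0, f, c;
      e * u 3 i, 0, -f, c, g] := by
    ext a b
    rw [hg]
    have c1 : (Fin.cons (stdb i) u : Fin 5 → Fin 5 → ℝ) 0 = stdb i := rfl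
    have c2 : (Fin.cons (stdb i) u : Fin 5 → Fin 5 → ℝ) 1 = u 0 := rfl
    have c3 : (Fin.cons (stdb i) u : Fin 5 → Fin 5 → ℝ) 2 = u 1 := rfl
    have c4 : (Fin.cons (stdb i) u : Fin 5 → Fin 5 → ℝ) 3 = u 2 := rfl
    have c5 : (Fin.cons (stdb i) u : Fin 5 → Fin 5 → ℝ) 4 = u 3 := rfl
    have g1 := fun k => comm (u k) (stdb i)
    have g2 := comm (u 1) (u 0)
    have g3 := comm (u 2) (u 0)
    have g4 := comm (u 3) (u 0)
    have g5 := comm (u 2) (u 1)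
    have g6 := comm (u 3) (u 1)
    have g7 := comm (u 3) (u 2)
    fin_cases a <;> fin_cases b <;>
      simp [c1, c2, c3, c4, c5, g1, g2, g3, g4, g5, g6, g7, hs, hsi, h00, h01, h02, h03, h11,
        h12, h13, h22, h23, h33]
  rw [← key, Matrix.det_mul, Matrix.det_mul, Matrix.det_transpose]
  have hJd : J.det = -1 := by
    simp [hJ, Matrix.det_diagonal, Fin.prod_univ_five]
  rw [hJd]
  have : lorentzProd u i = (if i = 0 then (-1 : ℝ) else 1) * M.det := rfl
  rw [this]
  split_ifs <;> ring

theorem gram_det (e a b c' d f g c : ℝ) :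
    (!![e, e * a, e * b, e * c', e * d;
      e * a, 0, 0, -1, 0;
      e * b, 0, 1, 0, -f;
      e * c', -1, 0, f, c;
      e * d, 0, -f, c, g] : Matrix (Fin 5) (Fin 5) ℝ).det = e * (f ^ 2 - g)
      - e ^ 2 * ((f * g - c ^ 2 - f ^ 3) * a ^ 2 - 2 * (f * c) * a * b + 2 * (g - f ^ 2) * a * c'
        - 2 * c * a * d - g * b ^ 2 - 2 * f * b * d - d ^ 2) := by
  simp [Matrix.det_succ_row_zero, Fin.sum_univ_succ, Fin.succAbove]
  ring

theorem lorentz_norm (u : Fin 4 → Fin 5 → ℝ) (f g c : ℝ)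
    (h00 : mink5 (u 0) (u 0) = 0) (h01 : mink5 (u 0) (u 1) = 0)
    (h02 : mink5 (u 0) (u 2) = -1) (h03 : mink5 (u 0) (u 3) = 0)
    (h11 : mink5 (u 1) (u 1) = 1) (h12 : mink5 (u 1) (u 2) = 0)
    (h13 : mink5 (u 1) (u 3) = -f) (h22 : mink5 (u 2) (u 2) = f)
    (h23 : mink5 (u 2) (u 3) = c) (h33 : mink5 (u 3) (u 3) = g) :
    mink5 (lorentzProd u) (lorentzProd u) = g - f ^ 2 := by
  have h := lorentz_comp_sq u f g c h00 h01 h02 h03 h11 h12 h13 h22 h23 h33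
  have k0 := h 0 (-1) (by simp)
  have k1 := h 1 1 (by simp)
  have k2 := h 2 1 (by simp)
  have k3 := h 3 1 (by simp)
  have k4 := h 4 1 (by simp)
  rw [gram_det] at k0 k1 k2 k3 k4
  simp only [mink5] at h00 h01 h02 h03 h11 h12 h13 h22 h23 h33 ⊢
  linear_combination -k0 + k1 + k2 + k3 + k4 + (f * g - c ^ 2 - f ^ 3) * h00
    - 2 * (f * c) * h01 + 2 * (g - f ^ 2) * h02 - 2 * c * h03 - g * h11 - 2 * f * h13 - h33

/-- For the light-cone lift `m` of a space curve parameterized by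
arc-length (`⟨m,m⟩ = 0`, `⟨m',m'⟩ = 1`), the Lorentz vector product
`X = m × m' × m'' × m'''` satisfies `⟨X, X⟩ = F₃ − F₂²` where `F₂ = ⟨m'',m''⟩` and
`F₃ = ⟨m''',m'''⟩`. (For a curve of curvature `κ` and torsion `τ` this is
`(κ')² + κ²τ² = ν²`, the square of Liebmann's conformal arc-length density, so the
normalized `X` is the curve of osculating spheres.) -/
theorem lorentzProd_norm_eq_nu_sq
    (m : ℝ → Fin 5 → ℝ) (hm : ContDiff ℝ (⊤ : ℕ∞) m)
    (h0 : ∀ s, mink5 (m s) (m s) = 0)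
    (h1 : ∀ s, mink5 (deriv m s) (deriv m s) = 1)
    (F₂ F₃ : ℝ → ℝ)
    (hF₂ : ∀ s, F₂ s = mink5 (iteratedDeriv 2 m s) (iteratedDeriv 2 m s))
    (hF₃ : ∀ s, F₃ s = mink5 (iteratedDeriv 3 m s) (iteratedDeriv 3 m s))
    (X : ℝ → Fin 5 → ℝ)
    (hX : ∀ s, X s = lorentzProd (fun k : Fin 4 => iteratedDeriv k m s)) :
    ∀ s : ℝ, mink5 (X s) (X s) = F₃ s - F₂ s ^ 2 := by
  intro s
  have hd : ∀ n t, HasDerivAt (iteratedDeriv n m) (iteratedDeriv (n + 1) m t) t := by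
    intro n t
    rw [iteratedDeriv_succ]
    refine DifferentiableAt.hasDerivAt ?_
    exact (hm.differentiable_iteratedDeriv n (by exact_mod_cast WithTop.coe_lt_top n)) t
  have hc : ∀ i j (k : ℝ), (∀ t, mink5 (iteratedDeriv i m t) (iteratedDeriv j m t) = k) →
      ∀ t, mink5 (iteratedDeriv (i + 1) m t) (iteratedDeriv j m t)
        + mink5 (iteratedDeriv i m t) (iteratedDeriv (j + 1) m t) = 0 := by
    intro i j k h t
    have h2 := mink5_hasDerivAt (hd i t) (hd j t)
    simp only [h] at h2
    exact h2.unique (hasDerivAt_const t k)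
  have comm : ∀ x y, mink5 x y = mink5 y x := by
    intro x y; simp only [mink5]; ring
  have e00 : ∀ t, mink5 (iteratedDeriv 0 m t) (iteratedDeriv 0 m t) = 0 := by
    simpa using h0
  have e11 : ∀ t, mink5 (iteratedDeriv 1 m t) (iteratedDeriv 1 m t) = 1 := by
    simpa using h1
  have e01 : ∀ t, mink5 (iteratedDeriv 0 m t) (iteratedDeriv 1 m t) = 0 := by
    intro t
    have := hc 0 0 0 e00 t
    have h' := comm (iteratedDeriv 1 m t) (iteratedDeriv 0 m t)
    simp only [zero_add] at this
    linarith
  have e12 : ∀ t, mink5 (iteratedDeriv 1 m t) (iteratedDeriv 2 m t) = 0 := by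
    intro t
    have := hc 1 1 1 e11 t
    have h' := comm (iteratedDeriv 2 m t) (iteratedDeriv 1 m t)
    simp only [Nat.reduceAdd] at this
    linarith
  have e02 : ∀ t, mink5 (iteratedDeriv 0 m t) (iteratedDeriv 2 m t) = -1 := by
    intro t
    have := hc 0 1 0 e01 t
    have h' := e11 t
    simp only [zero_add, Nat.reduceAdd] at this
    linarith
  have e03 : ∀ t, mink5 (iteratedDeriv 0 m t) (iteratedDeriv 3 m t) = 0 := by
    intro t
    have := hc 0 2 (-1) e02 t
    have h' := e12 t
    simp only [zero_add, Nat.reduceAdd] at this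
    linarith
  have e13 : ∀ t, mink5 (iteratedDeriv 1 m t) (iteratedDeriv 3 m t) = - F₂ t := by
    intro t
    have := hc 1 2 0 e12 t
    have h' := hF₂ t
    simp only [Nat.reduceAdd] at this
    linarith
  rw [hX]
  exact lorentz_norm _ (F₂ s) (F₃ s) _ (e00 s) (e01 s) (e02 s) (e03 s) (e11 s) (e12 s) (e13 s)
    (hF₂ s).symm rfl (hF₃ s).symm
end
end

section
/- Let x : ℝ → ℝ³ be a C^∞ unit-speed curve with κ := ‖x''‖ > 0 everywhere, torsion τ := det(x', x'', x''')/κ², and assume ν := √((κ')² + κ²τ²) > 0 everywhere (the curve is vertex-free). Let m : ℝ → ℝ⁵ be the light-cone lift m(s) = (1/√2 + (x·x)/(2√2), −1/√2 + (x·x)/(2√2), x(s)), and let σ(s) = (m × m' × m'' × m''')(s)/ν(s) be the (unit) curve of osculating spheres, where × is the Lorentz vector product. Then for all s: ⟨σ'(s), σ'(s)⟩ = (2(κ')²τ + κ²τ³ + κκ'τ' − κκ''τ)² / ((κ')² + κ²τ²)². (Since d ρ = √ν ds for the conformal arc-length ρ, this yields the Euclidean expression T = ±(2(κ')²τ + κ²τ³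 + κκ'τ' − κκ''τ)/ν^{5/2} for the conformal torsion.) -/
noncomputable section

set_option maxHeartbeats 4000000 in
theorem lp_aux (r x0 x1 x2 a0 a1 a2 b0 b1 b2 c0 c1 c2 : ℝ) (h8 : 8 * r ^ 2 = 1)
    (u : Fin 4 → Fin 5 → ℝ)
    (hu0 : u 0 = ![r * ((x0*x0+x1*x1+x2*x2) + 2), r * ((x0*x0+x1*x1+x2*x2) - 2), x0, x1, x2])
    (hu1 : u 1 = ![r * (2*(x0*a0+x1*a1+x2*a2)), r * (2*(x0*a0+x1*a1+x2*a2)), a0, a1, a2])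
    (hu2 : u 2 = ![r * (2*(1+(x0*b0+x1*b1+x2*b2))), r * (2*(1+(x0*b0+x1*b1+x2*b2))), b0, b1, b2])
    (hu3 : u 3 = ![r * (2*(x0*c0+x1*c1+x2*c2)), r * (2*(x0*c0+x1*c1+x2*c2)), c0, c1, c2])
    (D e0 e1 e2 : ℝ)
    (hD : D = a0*(b1*c2-b2*c1)-a1*(b0*c2-b2*c0)+a2*(b0*c1-b1*c0))
    (he0 : e0 = c1*a2-c2*a1) (he1 : e1 = c2*a0-c0*a2) (he2 : e2 = c0*a1-c1*a0) :
    lorentzProd u = ![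
      (r*(D*((x0*x0+x1*x1+x2*x2)+2) + 2*(e0*x0+e1*x1+e2*x2))),
      (r*(D*((x0*x0+x1*x1+x2*x2)-2) + 2*(e0*x0+e1*x1+e2*x2))),
      (D*x0+e0), (D*x1+e1), (D*x2+e2)] := by
  have hc0 : ∀ i, (Fin.cons (stdb i) u : Fin 5 → Fin 5 → ℝ) 0 = stdb i := fun i => rfl
  have hc1 : ∀ i, (Fin.cons (stdb i) u : Fin 5 → Fin 5 → ℝ) 1 = u 0 := fun i => rfl
  have hc2 : ∀ i, (Fin.cons (stdb i) u : Fin 5 → Fin 5 → ℝ) 2 = u 1 := fun i => rfl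
  have hc3 : ∀ i, (Fin.cons (stdb i) u : Fin 5 → Fin 5 → ℝ) 3 = u 2 := fun i => rfl
  have hc4 : ∀ i, (Fin.cons (stdb i) u : Fin 5 → Fin 5 → ℝ) 4 = u 3 := fun i => rfl
  have hM : ∀ i, (Matrix.of fun k j : Fin 5 => (Fin.cons (stdb i) u : Fin 5 → Fin 5 → ℝ) j k)
      = Matrix.of ![![stdb i 0, u 0 0, u 1 0, u 2 0, u 3 0],
        ![stdb i 1, u 0 1, u 1 1, u 2 1, u 3 1],
        ![stdb i 2, u 0 2, u 1 2, u 2 2, u 3 2],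
        ![stdb i 3, u 0 3, u 1 3, u 2 3, u 3 3],
        ![stdb i 4, u 0 4, u 1 4, u 2 4, u 3 4]] := by
    intro i
    ext k j
    fin_cases k <;> fin_cases j <;> rfl
  funext i
  unfold lorentzProd
  rw [hM i, hu0, hu1, hu2, hu3]
  subst hD he0 he1 he2
  fin_cases i
  all_goals
    simp [Matrix.det_succ_column_zero, Fin.sum_univ_succ, Fin.succAbove, stdb, Matrix.submatrix]
  · ring
  · ring
  · linear_combination ((a0*(b1*c2-b2*c1)-a1*(b0*c2-b2*c0)+a2*(b0*c1-b1*c0))*x0+(c1*a2-c2*a1))*h8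
  · linear_combination ((a0*(b1*c2-b2*c1)-a1*(b0*c2-b2*c0)+a2*(b0*c1-b1*c0))*x1+(c2*a0-c0*a2))*h8
  · linear_combination ((a0*(b1*c2-b2*c1)-a1*(b0*c2-b2*c0)+a2*(b0*c1-b1*c0))*x2+(c0*a1-c1*a0))*h8

theorem mink_aux (r x0 x1 x2 D D' e0 e1 e2 f0 f1 f2 : ℝ) (h8 : 8 * r ^ 2 = 1) :
    mink5 ![(r*(D*((x0*x0+x1*x1+x2*x2)+2) + 2*(e0*x0+e1*x1+e2*x2))),
      (r*(D*((x0*x0+x1*x1+x2*x2)-2) + 2*(e0*x0+e1*x1+e2*x2))), D*x0+e0, D*x1+e1, D*x2+e2]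
      ![(r*(D'*((x0*x0+x1*x1+x2*x2)+2) + 2*(f0*x0+f1*x1+f2*x2))),
      (r*(D'*((x0*x0+x1*x1+x2*x2)-2) + 2*(f0*x0+f1*x1+f2*x2))), D'*x0+f0, D'*x1+f1, D'*x2+f2]
      = e0*f0+e1*f1+e2*f2 := by
  simp only [mink5, Matrix.cons_val]
  linear_combination (-(D*D'*(x0*x0+x1*x1+x2*x2) + D*(f0*x0+f1*x1+f2*x2)
    + D'*(e0*x0+e1*x1+e2*x2)))*h8

theorem lagr_aux (a0 a1 a2 e0 e1 e2 f0 f1 f2 : ℝ) (aa : a0*a0+a1*a1+a2*a2 = 1)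
    (ae : a0*e0+a1*e1+a2*e2 = 0) (af : a0*f0+a1*f1+a2*f2 = 0) :
    (e0*e0+e1*e1+e2*e2)*(f0*f0+f1*f1+f2*f2) - (e0*f0+e1*f1+e2*f2)^2 =
    (a0*(e1*f2-e2*f1)-a1*(e0*f2-e2*f0)+a2*(e0*f1-e1*f0))^2 := by
  have key : (a0*(e1*f2-e2*f1)-a1*(e0*f2-e2*f0)+a2*(e0*f1-e1*f0))^2 =
    (a0*a0+a1*a1+a2*a2)*((e0*e0+e1*e1+e2*e2)*(f0*f0+f1*f1+f2*f2) - (e0*f0+e1*f1+e2*f2)^2)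
    - (a0*e0+a1*e1+a2*e2)*((a0*e0+a1*e1+a2*e2)*(f0*f0+f1*f1+f2*f2)
        - (a0*f0+a1*f1+a2*f2)*(e0*f0+e1*f1+e2*f2))
    + (a0*f0+a1*f1+a2*f2)*((a0*e0+a1*e1+a2*e2)*(e0*f0+e1*f1+e2*f2)
        - (a0*f0+a1*f1+a2*f2)*(e0*e0+e1*e1+e2*e2)) := by ring
  rw [key, aa, ae, af]; ring

theorem Q_aux (a0 a1 a2 b0 b1 b2 c0 c1 c2 d0 d1 d2 D D' e0 e1 e2 f0 f1 f2 K : ℝ)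
    (aa : a0*a0+a1*a1+a2*a2 = 1) (ab : a0*b0+a1*b1+a2*b2 = 0) (ac : a0*c0+a1*c1+a2*c2 = -K)
    (bb : b0*b0+b1*b1+b2*b2 = K)
    (hD : D = a0*(b1*c2-b2*c1)-a1*(b0*c2-b2*c0)+a2*(b0*c1-b1*c0))
    (hD' : D' = a0*(b1*d2-b2*d1)-a1*(b0*d2-b2*d0)+a2*(b0*d1-b1*d0))
    (he0 : e0 = c1*a2-c2*a1) (he1 : e1 = c2*a0-c0*a2) (he2 : e2 = c0*a1-c1*a0)
    (hf0 : f0 = D*a0 + ((d1*a2-d2*a1)+(c1*b2-c2*b1)))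
    (hf1 : f1 = D*a1 + ((d2*a0-d0*a2)+(c2*b0-c0*b2)))
    (hf2 : f2 = D*a2 + ((d0*a1-d1*a0)+(c0*b1-c1*b0))) :
    (a0*e0+a1*e1+a2*e2 = 0) ∧ (a0*f0+a1*f1+a2*f2 = 0) ∧
    K * (a0*(e1*f2-e2*f1)-a1*(e0*f2-e2*f0)+a2*(e0*f1-e1*f0)) =
      (b0*c0+b1*c1+b2*c2)*D' - (b0*d0+b1*d1+b2*d2)*D - K^2*D ∧
    D^2 = K*(c0*c0+c1*c1+c2*c2) - (b0*c0+b1*c1+b2*c2)^2 - K^3 ∧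
    e0*e0+e1*e1+e2*e2 = (c0*c0+c1*c1+c2*c2) - K^2 := by
  refine ⟨?_, ?_, ?_, ?_, ?_⟩
  · subst he0 he1 he2; ring
  · subst hf0 hf1 hf2
    linear_combination D*aa + hD
  · have h1 : a0*(e1*f2-e2*f1)-a1*(e0*f2-e2*f0)+a2*(e0*f1-e1*f0) =
      (a0*a0+a1*a1+a2*a2)*(a0*(c1*d2-c2*d1)-a1*(c0*d2-c2*d0)+a2*(c0*d1-c1*d0))
      + (a0*c0+a1*c1+a2*c2)*(a0*(b1*c2-b2*c1)-a1*(b0*c2-b2*c0)+a2*(b0*c1-b1*c0)) := by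
      subst he0 he1 he2 hf0 hf1 hf2; ring
    rw [h1, aa, ac, ← hD]
    have h2 : (b0*b0+b1*b1+b2*b2)*(a0*(c1*d2-c2*d1)-a1*(c0*d2-c2*d0)+a2*(c0*d1-c1*d0)) =
      (a0*b0+a1*b1+a2*b2)*(b0*(c1*d2-c2*d1)-b1*(c0*d2-c2*d0)+b2*(c0*d1-c1*d0))
      + (b0*c0+b1*c1+b2*c2)*(a0*(b1*d2-b2*d1)-a1*(b0*d2-b2*d0)+a2*(b0*d1-b1*d0))
      - (b0*d0+b1*d1+b2*d2)*(a0*(b1*c2-b2*c1)-a1*(b0*c2-b2*c0)+a2*(b0*c1-b1*c0)) := by ring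
    rw [bb, ab, ← hD, ← hD'] at h2
    linear_combination h2
  · have h1 : (a0*(b1*c2-b2*c1)-a1*(b0*c2-b2*c0)+a2*(b0*c1-b1*c0))^2 =
      (a0*a0+a1*a1+a2*a2)*((b0*b0+b1*b1+b2*b2)*(c0*c0+c1*c1+c2*c2) - (b0*c0+b1*c1+b2*c2)^2)
      - (a0*b0+a1*b1+a2*b2)*((a0*b0+a1*b1+a2*b2)*(c0*c0+c1*c1+c2*c2)
         - 2*(b0*c0+b1*c1+b2*c2)*(a0*c0+a1*c1+a2*c2))
      - (a0*c0+a1*c1+a2*c2)^2*(b0*b0+b1*b1+b2*b2) := by ring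
    rw [hD, h1, aa, ab, ac, bb]; ring
  · have h1 : e0*e0+e1*e1+e2*e2 = (a0*a0+a1*a1+a2*a2)*(c0*c0+c1*c1+c2*c2)
      - (a0*c0+a1*c1+a2*c2)^2 := by subst he0 he1 he2; ring
    rw [h1, aa, ac]; ring

theorem scal_aux (k k1 k2 t t1 D D' bc bd C Q : ℝ) (hk : k ≠ 0)
    (h1 : bc = k * k1) (h2 : bd + C = k1^2 + k*k2) (h3 : D = k^2*t)
    (h4 : D' = 2*k*k1*t + k^2*t1)
    (h5 : D^2 = k^2*C - bc^2 - (k^2)^3)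
    (h6 : k^2*Q = bc*D' - bd*D - (k^2)^2*D) :
    Q = 2 * k1 ^ 2 * t + k ^ 2 * t ^ 3 + k * k1 * t1 - k * k2 * t ∧
    C - (k^2)^2 = k1^2 + k^2*t^2 := by
  have hC : C = k^2*t^2 + k1^2 + k^4 := by
    apply mul_left_cancel₀ (pow_ne_zero 2 hk)
    subst h1 h3
    linear_combination -h5
  refine ⟨?_, by rw [hC]; ring⟩
  apply mul_left_cancel₀ (pow_ne_zero 2 hk)
  have hbd : bd = k1^2 + k*k2 - C := by linarith
  rw [h6, hbd, hC, h1, h3, h4]; ring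

theorem fin_aux (w v : Fin 5 → ℝ) (n n' N F G Q : ℝ) (hn : 0 < n) (hN : n^2 = N)
    (hww : mink5 w w = N) (hwv : mink5 w v = G) (hvv : mink5 v v = F)
    (hn' : n * n' = G) (hQ : N * F - G^2 = Q^2) :
    mink5 (n⁻¹ • v + (-n' / n^2) • w) (n⁻¹ • v + (-n' / n^2) • w) = Q^2 / N^2 := by
  have h : mink5 (n⁻¹ • v + (-n' / n^2) • w) (n⁻¹ • v + (-n' / n^2) • w) =
      (n⁻¹)^2 * mink5 v v + 2 * n⁻¹ * (-n' / n^2) * mink5 w v + (-n' / n^2)^2 * mink5 w w := by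
    simp only [mink5, Pi.add_apply, Pi.smul_apply, smul_eq_mul]; ring
  rw [h, hww, hwv, hvv, ← hQ, ← hN, ← hn']
  field_simp
  ring

/-- **Euclidean expression of the conformal torsion.** Let `x` be a
vertex-free unit-speed space curve with curvature `κ > 0`, torsion `τ`, and
`ν = √((κ')² + κ²τ²) > 0`; let `m` be its light-cone lift into `ℝ⁵₁` and
`σ = (m × m' × m'' × m''')/ν` the unit curve of osculating spheres. Then
`⟨σ',σ'⟩ = (2(κ')²τ + κ²τ³ + κκ'τ' − κκ''τ)² / ((κ')² + κ²τ²)²`; since `dρ = √ν ds`,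
this yields the Euclidean formula `T = ±(2(κ')²τ + κ²τ³ + κκ'τ' − κκ''τ)/ν^{5/2}` for
the conformal torsion. -/
theorem conformal_torsion_euclidean_expression
    (x : ℝ → EuclideanSpace ℝ (Fin 3)) (hx : ContDiff ℝ (⊤ : ℕ∞) x)
    (hunit : ∀ s, ‖deriv x s‖ = 1)
    (κ : ℝ → ℝ) (hκdef : ∀ s, κ s = ‖iteratedDeriv 2 x s‖)
    (hκpos : ∀ s, 0 < κ s)
    (τ : ℝ → ℝ)
    (hτ : ∀ s, τ s =
      (Matrix.of fun i j : Fin 3 =>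
        ![deriv x s, iteratedDeriv 2 x s, iteratedDeriv 3 x s] j i).det / κ s ^ 2)
    (ν : ℝ → ℝ)
    (hν : ∀ s, ν s = Real.sqrt (deriv κ s ^ 2 + κ s ^ 2 * τ s ^ 2))
    (hνpos : ∀ s, 0 < ν s)
    (m : ℝ → Fin 5 → ℝ)
    (hm : ∀ s, m s =
      ![1 / Real.sqrt 2 + (∑ i, x s i * x s i) / (2 * Real.sqrt 2),
        -1 / Real.sqrt 2 + (∑ i, x s i * x s i) / (2 * Real.sqrt 2),
        x s 0, x s 1, x s 2])
    (σ : ℝ → Fin 5 → ℝ)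
    (hσ : ∀ s, σ s = (ν s)⁻¹ • lorentzProd (fun k : Fin 4 => iteratedDeriv k m s)) :
    ∀ s : ℝ, mink5 (deriv σ s) (deriv σ s) =
      (2 * deriv κ s ^ 2 * τ s + κ s ^ 2 * τ s ^ 3 + κ s * deriv κ s * deriv τ s
          - κ s * iteratedDeriv 2 κ s * τ s) ^ 2 /
        (deriv κ s ^ 2 + κ s ^ 2 * τ s ^ 2) ^ 2 := by
  have hP : ∀ (k : ℕ) (i : Fin 3) (s : ℝ),
      HasDerivAt (fun s => iteratedDeriv k x s i) (iteratedDeriv (k+1) x s i) s := by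
    intro k i s
    have h1 : DifferentiableAt ℝ (iteratedDeriv k x) s :=
      (hx.differentiable_iteratedDeriv k (by exact_mod_cast WithTop.coe_lt_top _)) s
    have h2 := h1.hasDerivAt
    rw [← iteratedDeriv_succ] at h2
    exact ((EuclideanSpace.proj (𝕜 := ℝ) i).hasFDerivAt.comp_hasDerivAt s h2)
  obtain ⟨P, hPdef⟩ : ∃ P : ℕ → Fin 3 → ℝ → ℝ, P = fun k i s => iteratedDeriv k x s i := ⟨_, rfl⟩
  have hp : ∀ (k : ℕ) (i : Fin 3) (s : ℝ), HasDerivAt (P k i) (P (k+1) i s) s := by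
    rw [hPdef]; exact hP
  have hdot : ∀ (j k : ℕ) (s : ℝ), HasDerivAt
      (fun s => P j 0 s * P k 0 s + P j 1 s * P k 1 s + P j 2 s * P k 2 s)
      ((P (j+1) 0 s * P k 0 s + P (j+1) 1 s * P k 1 s + P (j+1) 2 s * P k 2 s)
       + (P j 0 s * P (k+1) 0 s + P j 1 s * P (k+1) 1 s + P j 2 s * P (k+1) 2 s)) s := by
    intro j k s
    refine HasDerivAt.congr_deriv ((((hp j 0 s).fun_mul (hp k 0 s)).fun_add ((hp j 1 s).fun_mul (hp k 1 s))).fun_add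
      ((hp j 2 s).fun_mul (hp k 2 s))) ?_
    ring
  have hmin : ∀ (j k l n : ℕ) (u v w z : Fin 3) (s : ℝ), HasDerivAt
      (fun s => P j u s * P k v s - P l w s * P n z s)
      ((P (j+1) u s * P k v s + P j u s * P (k+1) v s)
        - (P (l+1) w s * P n z s + P l w s * P (n+1) z s)) s := by
    intro j k l n u v w z s
    exact ((hp j u s).fun_mul (hp k v s)).fun_sub ((hp l w s).fun_mul (hp n z s))
  -- the orthogonality relations
  have aa : ∀ s, P 1 0 s * P 1 0 s + P 1 1 s * P 1 1 s + P 1 2 s * P 1 2 s = 1 := by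
    intro s
    have h := hunit s
    have h2 : ‖deriv x s‖ ^ 2 = 1 := by rw [h]; norm_num
    rw [EuclideanSpace.real_norm_sq_eq, Fin.sum_univ_three] at h2
    simp only [hPdef, iteratedDeriv_one]
    linarith
  have ab : ∀ s, P 1 0 s * P 2 0 s + P 1 1 s * P 2 1 s + P 1 2 s * P 2 2 s = 0 := by
    intro s
    have h := (hdot 1 1 s)
    rw [funext aa] at h
    have := h.unique (hasDerivAt_const s (1:ℝ))
    norm_num at this
    linarith
  have ac : ∀ s, P 1 0 s * P 3 0 s + P 1 1 s * P 3 1 s + P 1 2 s * P 3 2 s =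
      -(P 2 0 s * P 2 0 s + P 2 1 s * P 2 1 s + P 2 2 s * P 2 2 s) := by
    intro s
    have h := (hdot 1 2 s)
    rw [funext ab] at h
    have := h.unique (hasDerivAt_const s (0:ℝ))
    norm_num at this
    linarith
  -- curvature
  have bb : ∀ s, P 2 0 s * P 2 0 s + P 2 1 s * P 2 1 s + P 2 2 s * P 2 2 s = κ s ^ 2 := by
    intro s
    rw [hκdef, EuclideanSpace.real_norm_sq_eq, Fin.sum_univ_three]
    simp only [hPdef]
    ring
  have hκd : ∀ s, DifferentiableAt ℝ κ s := by
    intro s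
    have h1 : κ = fun s => Real.sqrt
        (P 2 0 s * P 2 0 s + P 2 1 s * P 2 1 s + P 2 2 s * P 2 2 s) := by
      funext t
      rw [bb, Real.sqrt_sq (hκpos t).le]
    rw [h1]
    exact ((hdot 2 2 s).sqrt (by rw [bb]; exact pow_ne_zero 2 (hκpos s).ne')).differentiableAt
  have bc : ∀ s, P 2 0 s * P 3 0 s + P 2 1 s * P 3 1 s + P 2 2 s * P 3 2 s =
      κ s * deriv κ s := by
    intro s
    have h := hdot 2 2 s
    rw [funext bb] at h
    have := h.unique ((hκd s).hasDerivAt.fun_pow 2)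
    norm_num at this
    linarith
  have hκdd : ∀ s, DifferentiableAt ℝ (deriv κ) s := by
    intro s
    have h1 : deriv κ = fun s =>
        (P 2 0 s * P 3 0 s + P 2 1 s * P 3 1 s + P 2 2 s * P 3 2 s) / κ s := by
      funext t
      rw [bc, mul_div_cancel_left₀ _ (hκpos t).ne']
    rw [h1]
    exact (hdot 2 3 s).differentiableAt.fun_div (hκd s) (hκpos s).ne'
  have bd : ∀ s, (P 2 0 s * P 4 0 s + P 2 1 s * P 4 1 s + P 2 2 s * P 4 2 s) +
      (P 3 0 s * P 3 0 s + P 3 1 s * P 3 1 s + P 3 2 s * P 3 2 s) =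
      deriv κ s ^ 2 + κ s * iteratedDeriv 2 κ s := by
    intro s
    have h := hdot 2 3 s
    rw [funext bc] at h
    have := h.unique ((hκd s).hasDerivAt.fun_mul (hκdd s).hasDerivAt)
    norm_num at this
    rw [show iteratedDeriv 2 κ s = deriv (deriv κ) s by
      rw [iteratedDeriv_succ, iteratedDeriv_one]]
    linarith
  -- torsion
  obtain ⟨D, hD⟩ : ∃ D : ℝ → ℝ, D = fun s =>
    P 1 0 s * (P 2 1 s * P 3 2 s - P 2 2 s * P 3 1 s)
    - P 1 1 s * (P 2 0 s * P 3 2 s - P 2 2 s * P 3 0 s)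
    + P 1 2 s * (P 2 0 s * P 3 1 s - P 2 1 s * P 3 0 s) := ⟨_, rfl⟩
  obtain ⟨D', hD'⟩ : ∃ D' : ℝ → ℝ, D' = fun s =>
    P 1 0 s * (P 2 1 s * P 4 2 s - P 2 2 s * P 4 1 s)
    - P 1 1 s * (P 2 0 s * P 4 2 s - P 2 2 s * P 4 0 s)
    + P 1 2 s * (P 2 0 s * P 4 1 s - P 2 1 s * P 4 0 s) := ⟨_, rfl⟩
  have hDd : ∀ s, HasDerivAt D (D' s) s := by
    intro s
    rw [hD, hD']
    refine HasDerivAt.congr_deriv ((((hp 1 0 s).fun_mul (hmin 2 3 2 3 1 2 2 1 s)).fun_sub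
      ((hp 1 1 s).fun_mul (hmin 2 3 2 3 0 2 2 0 s))).fun_add
      ((hp 1 2 s).fun_mul (hmin 2 3 2 3 0 1 1 0 s))) ?_
    ring
  have hτ' : ∀ s, τ s = D s / κ s ^ 2 := by
    intro s
    rw [hτ, hD, Matrix.det_fin_three]
    simp only [hPdef, iteratedDeriv_one, Matrix.of_apply, Matrix.cons_val]
    congr 1
    ring
  have hDτ : ∀ s, D s = κ s ^ 2 * τ s := by
    intro s
    rw [hτ', mul_div_cancel₀ _ (pow_ne_zero 2 (hκpos s).ne')]
  have hτd : ∀ s, DifferentiableAt ℝ τ s := by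
    intro s
    rw [funext hτ']
    exact (hDd s).differentiableAt.fun_div ((hκd s).fun_pow 2) (pow_ne_zero 2 (hκpos s).ne')
  have hD'τ : ∀ s, D' s = 2 * κ s * deriv κ s * τ s + κ s ^ 2 * deriv τ s := by
    intro s
    have h := hDd s
    rw [funext hDτ] at h
    have := h.unique (((hκd s).hasDerivAt.fun_pow 2).fun_mul (hτd s).hasDerivAt)
    rw [this]
    norm_num
  -- the vector e = c × a
  obtain ⟨e0, he0⟩ : ∃ e : ℝ → ℝ, e = fun s => P 3 1 s * P 1 2 s - P 3 2 s * P 1 1 s := ⟨_, rfl⟩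
  obtain ⟨e1, he1⟩ : ∃ e : ℝ → ℝ, e = fun s => P 3 2 s * P 1 0 s - P 3 0 s * P 1 2 s := ⟨_, rfl⟩
  obtain ⟨e2, he2⟩ : ∃ e : ℝ → ℝ, e = fun s => P 3 0 s * P 1 1 s - P 3 1 s * P 1 0 s := ⟨_, rfl⟩
  obtain ⟨g0, hg0⟩ : ∃ g : ℝ → ℝ, g = fun s =>
    (P 4 1 s * P 1 2 s - P 4 2 s * P 1 1 s) + (P 3 1 s * P 2 2 s - P 3 2 s * P 2 1 s) := ⟨_, rfl⟩
  obtain ⟨g1, hg1⟩ : ∃ g : ℝ → ℝ, g = fun s =>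
    (P 4 2 s * P 1 0 s - P 4 0 s * P 1 2 s) + (P 3 2 s * P 2 0 s - P 3 0 s * P 2 2 s) := ⟨_, rfl⟩
  obtain ⟨g2, hg2⟩ : ∃ g : ℝ → ℝ, g = fun s =>
    (P 4 0 s * P 1 1 s - P 4 1 s * P 1 0 s) + (P 3 0 s * P 2 1 s - P 3 1 s * P 2 0 s) := ⟨_, rfl⟩
  have hed0 : ∀ s, HasDerivAt e0 (g0 s) s := by
    intro s
    rw [he0, hg0]
    refine HasDerivAt.congr_deriv (hmin 3 1 3 1 1 2 2 1 s) ?_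
    ring
  have hed1 : ∀ s, HasDerivAt e1 (g1 s) s := by
    intro s
    rw [he1, hg1]
    refine HasDerivAt.congr_deriv (hmin 3 1 3 1 2 0 0 2 s) ?_
    ring
  have hed2 : ∀ s, HasDerivAt e2 (g2 s) s := by
    intro s
    rw [he2, hg2]
    refine HasDerivAt.congr_deriv (hmin 3 1 3 1 0 1 1 0 s) ?_
    ring
  have hQ := fun s => Q_aux (P 1 0 s) (P 1 1 s) (P 1 2 s) (P 2 0 s) (P 2 1 s) (P 2 2 s)
    (P 3 0 s) (P 3 1 s) (P 3 2 s) (P 4 0 s) (P 4 1 s) (P 4 2 s) (D s) (D' s)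
    (e0 s) (e1 s) (e2 s) (D s * P 1 0 s + g0 s) (D s * P 1 1 s + g1 s) (D s * P 1 2 s + g2 s)
    (κ s ^ 2) (aa s) (ab s) ((ac s).trans (by rw [bb])) (bb s) (by rw [hD]) (by rw [hD'])
    (by rw [he0]) (by rw [he1]) (by rw [he2]) (by rw [hg0]) (by rw [hg1]) (by rw [hg2])
  have hS := fun s => scal_aux (κ s) (deriv κ s) (iteratedDeriv 2 κ s) (τ s) (deriv τ s)
    (D s) (D' s) _ _ _ _ (hκpos s).ne' (bc s) (bd s) (hDτ s) (hD'τ s) (hQ s).2.2.2.1 (hQ s).2.2.1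
  have hee : ∀ s, e0 s * e0 s + e1 s * e1 s + e2 s * e2 s =
      deriv κ s ^ 2 + κ s ^ 2 * τ s ^ 2 := fun s => (hQ s).2.2.2.2.trans (hS s).2
  have hν2 : ∀ s, ν s ^ 2 = deriv κ s ^ 2 + κ s ^ 2 * τ s ^ 2 := by
    intro s
    rw [hν, Real.sq_sqrt (by positivity)]
  have heed : ∀ s, HasDerivAt (fun s => e0 s * e0 s + e1 s * e1 s + e2 s * e2 s)
      (2 * (e0 s * g0 s + e1 s * g1 s + e2 s * g2 s)) s := by
    intro s
    refine HasDerivAt.congr_deriv ((((hed0 s).fun_mul (hed0 s)).fun_add ((hed1 s).fun_mul (hed1 s))).fun_add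
      ((hed2 s).fun_mul (hed2 s))) ?_
    ring
  have hνd : ∀ s, DifferentiableAt ℝ ν s := by
    intro s
    have h1 : ν = fun s => Real.sqrt (e0 s * e0 s + e1 s * e1 s + e2 s * e2 s) := by
      funext t
      rw [hν, hee]
    rw [h1]
    exact ((heed s).sqrt (by
      rw [hee, ← hν2]; exact pow_ne_zero 2 (hνpos s).ne')).differentiableAt
  have hνν : ∀ s, ν s * deriv ν s = e0 s * g0 s + e1 s * g1 s + e2 s * g2 s := by
    intro s
    have h := heed s
    rw [funext fun t => (hee t).trans (hν2 t).symm] at h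
    have := h.unique ((hνd s).hasDerivAt.fun_pow 2)
    norm_num at this
    linarith
  -- the lift and its derivatives
  obtain ⟨r, hr⟩ : ∃ r : ℝ, r = 1 / (2 * Real.sqrt 2) := ⟨_, rfl⟩
  have h8 : 8 * r ^ 2 = 1 := by
    rw [hr, div_pow, mul_pow, Real.sq_sqrt (by norm_num)]; norm_num
  have hm0 : m = fun s => ![
      r * ((P 0 0 s * P 0 0 s + P 0 1 s * P 0 1 s + P 0 2 s * P 0 2 s) + 2),
      r * ((P 0 0 s * P 0 0 s + P 0 1 s * P 0 1 s + P 0 2 s * P 0 2 s) - 2),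
      P 0 0 s, P 0 1 s, P 0 2 s] := by
    funext s
    have h2 : Real.sqrt 2 ≠ 0 := by positivity
    rw [hm, Fin.sum_univ_three, hr]
    simp only [hPdef, iteratedDeriv_zero]
    congr 1
    · field_simp
      ring
    · congr 1
      field_simp
      ring
  have hvec : ∀ (f0 f1 f2 f3 f4 : ℝ → ℝ) (d0 d1 d2 d3 d4 s : ℝ), HasDerivAt f0 d0 s →
      HasDerivAt f1 d1 s → HasDerivAt f2 d2 s → HasDerivAt f3 d3 s → HasDerivAt f4 d4 s →
      HasDerivAt (fun s => ![f0 s, f1 s, f2 s, f3 s, f4 s]) ![d0, d1, d2, d3, d4] s := by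
    intro f0 f1 f2 f3 f4 d0 d1 d2 d3 d4 s h0 h1 h2 h3 h4
    rw [hasDerivAt_pi]
    intro i
    fin_cases i
    · exact h0
    · exact h1
    · exact h2
    · exact h3
    · exact h4
  have hm1 : deriv m = fun s => ![
      r * (2 * (P 0 0 s * P 1 0 s + P 0 1 s * P 1 1 s + P 0 2 s * P 1 2 s)),
      r * (2 * (P 0 0 s * P 1 0 s + P 0 1 s * P 1 1 s + P 0 2 s * P 1 2 s)),
      P 1 0 s, P 1 1 s, P 1 2 s] := by
    funext s
    rw [hm0]
    refine (hvec _ _ _ _ _ _ _ _ _ _ s ?_ ?_ (hp 0 0 s) (hp 0 1 s) (hp 0 2 s)).deriv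
    · refine HasDerivAt.congr_deriv (((hdot 0 0 s).add_const 2).const_mul r) ?_
      ring
    · refine HasDerivAt.congr_deriv (((hdot 0 0 s).sub_const 2).const_mul r) ?_
      ring
  have hm2 : deriv (deriv m) = fun s => ![
      r * (2 * (1 + (P 0 0 s * P 2 0 s + P 0 1 s * P 2 1 s + P 0 2 s * P 2 2 s))),
      r * (2 * (1 + (P 0 0 s * P 2 0 s + P 0 1 s * P 2 1 s + P 0 2 s * P 2 2 s))),
      P 2 0 s, P 2 1 s, P 2 2 s] := by
    funext s
    rw [hm1]
    have h : HasDerivAt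
      (fun s => r * (2 * (P 0 0 s * P 1 0 s + P 0 1 s * P 1 1 s + P 0 2 s * P 1 2 s)))
      (r * (2 * (1 + (P 0 0 s * P 2 0 s + P 0 1 s * P 2 1 s + P 0 2 s * P 2 2 s)))) s := by
      refine HasDerivAt.congr_deriv (((hdot 0 1 s).const_mul 2).const_mul r) ?_
      rw [aa]
    exact (hvec _ _ _ _ _ _ _ _ _ _ s h h (hp 1 0 s) (hp 1 1 s) (hp 1 2 s)).deriv
  have hm3 : deriv (deriv (deriv m)) = fun s => ![
      r * (2 * (P 0 0 s * P 3 0 s + P 0 1 s * P 3 1 s + P 0 2 s * P 3 2 s)),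
      r * (2 * (P 0 0 s * P 3 0 s + P 0 1 s * P 3 1 s + P 0 2 s * P 3 2 s)),
      P 3 0 s, P 3 1 s, P 3 2 s] := by
    funext s
    rw [hm2]
    have h : HasDerivAt
      (fun s => r * (2 * (1 + (P 0 0 s * P 2 0 s + P 0 1 s * P 2 1 s + P 0 2 s * P 2 2 s))))
      (r * (2 * (P 0 0 s * P 3 0 s + P 0 1 s * P 3 1 s + P 0 2 s * P 3 2 s))) s := by
      refine HasDerivAt.congr_deriv ((((hdot 0 2 s).const_add 1).const_mul 2).const_mul r) ?_
      rw [ab, zero_add]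
    exact (hvec _ _ _ _ _ _ _ _ _ _ s h h (hp 2 0 s) (hp 2 1 s) (hp 2 2 s)).deriv
  -- the sphere curve
  obtain ⟨W, hW⟩ : ∃ W : ℝ → Fin 5 → ℝ, W = fun s => ![
      (r*(D s*((P 0 0 s*P 0 0 s+P 0 1 s*P 0 1 s+P 0 2 s*P 0 2 s)+2)
        + 2*(e0 s*P 0 0 s+e1 s*P 0 1 s+e2 s*P 0 2 s))),
      (r*(D s*((P 0 0 s*P 0 0 s+P 0 1 s*P 0 1 s+P 0 2 s*P 0 2 s)-2)
        + 2*(e0 s*P 0 0 s+e1 s*P 0 1 s+e2 s*P 0 2 s))),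
      D s*P 0 0 s+e0 s, D s*P 0 1 s+e1 s, D s*P 0 2 s+e2 s] := ⟨_, rfl⟩
  have hσW : σ = fun s => (ν s)⁻¹ • W s := by
    funext s
    rw [hσ, hW]
    congr 1
    refine lp_aux r _ _ _ (P 1 0 s) (P 1 1 s) (P 1 2 s) (P 2 0 s) (P 2 1 s) (P 2 2 s)
      (P 3 0 s) (P 3 1 s) (P 3 2 s) h8 _ ?_ ?_ ?_ ?_ _ _ _ _ ?_ ?_ ?_ ?_
    · simp only [Fin.val_zero, iteratedDeriv_zero]
      rw [hm0]
    · simp only [Fin.val_one, iteratedDeriv_one]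
      rw [hm1]
    · change iteratedDeriv 2 m s = _
      rw [iteratedDeriv_succ, iteratedDeriv_one, hm2]
    · change iteratedDeriv 3 m s = _
      rw [iteratedDeriv_succ, iteratedDeriv_succ, iteratedDeriv_one, hm3]
    · rw [hD]
    · rw [he0]
    · rw [he1]
    · rw [he2]
  intro s
  obtain ⟨hae, haf, -⟩ := hQ s
  obtain ⟨V, hV⟩ : ∃ V : Fin 5 → ℝ, V = ![
      (r*(D' s*((P 0 0 s*P 0 0 s+P 0 1 s*P 0 1 s+P 0 2 s*P 0 2 s)+2)
        + 2*((D s * P 1 0 s + g0 s)*P 0 0 s+(D s * P 1 1 s + g1 s)*P 0 1 s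
          +(D s * P 1 2 s + g2 s)*P 0 2 s))),
      (r*(D' s*((P 0 0 s*P 0 0 s+P 0 1 s*P 0 1 s+P 0 2 s*P 0 2 s)-2)
        + 2*((D s * P 1 0 s + g0 s)*P 0 0 s+(D s * P 1 1 s + g1 s)*P 0 1 s
          +(D s * P 1 2 s + g2 s)*P 0 2 s))),
      D' s*P 0 0 s+(D s * P 1 0 s + g0 s), D' s*P 0 1 s+(D s * P 1 1 s + g1 s),
      D' s*P 0 2 s+(D s * P 1 2 s + g2 s)] := ⟨_, rfl⟩
  have hWd : HasDerivAt W V s := by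
    rw [hW, hV]
    have hex := (((hed0 s).fun_mul (hp 0 0 s)).fun_add ((hed1 s).fun_mul (hp 0 1 s))).fun_add
      ((hed2 s).fun_mul (hp 0 2 s))
    refine hvec _ _ _ _ _ _ _ _ _ _ s ?_ ?_ ?_ ?_ ?_
    · refine HasDerivAt.congr_deriv ((((hDd s).fun_mul ((hdot 0 0 s).add_const 2)).fun_add
        (hex.const_mul 2)).const_mul r) ?_
      simp only [zero_add]
      linear_combination (2*r)*hae
    · refine HasDerivAt.congr_deriv ((((hDd s).fun_mul ((hdot 0 0 s).sub_const 2)).fun_add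
        (hex.const_mul 2)).const_mul r) ?_
      simp only [zero_add]
      linear_combination (2*r)*hae
    · refine HasDerivAt.congr_deriv (((hDd s).fun_mul (hp 0 0 s)).fun_add (hed0 s)) ?_
      ring
    · refine HasDerivAt.congr_deriv (((hDd s).fun_mul (hp 0 1 s)).fun_add (hed1 s)) ?_
      ring
    · refine HasDerivAt.congr_deriv (((hDd s).fun_mul (hp 0 2 s)).fun_add (hed2 s)) ?_
      ring
  have hσd : deriv σ s = (ν s)⁻¹ • V + (-deriv ν s / ν s ^ 2) • W s := by
    rw [hσW]
    exact (((hνd s).hasDerivAt.fun_inv (hνpos s).ne').fun_smul hWd).deriv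
  rw [hσd, ← (hS s).1]
  have hvv : mink5 V V = (D s * P 1 0 s + g0 s) * (D s * P 1 0 s + g0 s) + (D s * P 1 1 s + g1 s) * (D s * P 1 1 s + g1 s) + (D s * P 1 2 s + g2 s) * (D s * P 1 2 s + g2 s) := by
    rw [hV]; exact mink_aux r _ _ _ _ _ _ _ _ _ _ _ h8
  have hwv : mink5 (W s) V = e0 s * (D s * P 1 0 s + g0 s) + e1 s * (D s * P 1 1 s + g1 s) + e2 s * (D s * P 1 2 s + g2 s) := by
    rw [hV, hW]; exact mink_aux r _ _ _ _ _ _ _ _ _ _ _ h8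
  refine fin_aux (W s) V (ν s) (deriv ν s) _ _ _ _ (hνpos s) (hν2 s) ?_ hwv hvv ?_ ?_
  · rw [hW, ← hee]
    exact mink_aux r _ _ _ _ _ _ _ _ _ _ _ h8
  · rw [hνν]
    linear_combination (-D s)*hae
  · rw [← hee]
    exact lagr_aux _ _ _ _ _ _ _ _ _ (aa s) hae haf
end
end
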